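/- Let n ≥ 5 and let A be an n×n matrix with all entries in {−1,1} whose rank over ℚ equals r+1 for some integer 0 ≤ r ≤ n−1. Then |per A| ≤ per D_{(n,r)}. -/

import Mathlib

open Matrix

/-- The permanent of a square matrix. -/
def per {n : ℕ} (A : Matrix (Fin n) (Fin n) ℚ) : ℚ :=
  ∑ σ : Equiv.Perm (Fin n), ∏ i, A i (σ i)

/-- The square matrix `D_{(n,l)}`: `-1` on the first `l` diagonal entries, `1` elsewhere. -/
def Dmat (n l : ℕ) : Matrix (Fin n) (Fin n) ℚ :=
  fun i j => if (i : ℕ) = (j : ℕ) ∧ (j : ℕ) < l then -1 else 1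

/-- The permanent of a matrix whose rows and columns may be indexed by different types. -/
def genPer {ι κ : Type} [Fintype ι] [DecidableEq ι] [Fintype κ] [DecidableEq κ]
    (A : Matrix ι κ ℚ) : ℚ :=
  ∑ σ : ι ≃ κ, ∏ i, A i (σ i)

section genPer

variable {ι κ ι' κ' : Type} [Fintype ι] [DecidableEq ι] [Fintype κ] [DecidableEq κ]
  [Fintype ι'] [DecidableEq ι'] [Fintype κ'] [DecidableEq κ']

theorem genPer_submatrix_equiv (A : Matrix ι κ ℚ) (e : ι' ≃ ι) (f : κ' ≃ κ) :
    genPer (A.submatrix e f) = genPer A := by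
  unfold genPer
  refine Fintype.sum_equiv (Equiv.equivCongr e f) _ _ fun σ => ?_
  refine Fintype.prod_equiv e _ _ fun i => ?_
  simp [Equiv.equivCongr]

theorem genPer_transpose (A : Matrix ι κ ℚ) : genPer Aᵀ = genPer A := by
  unfold genPer
  refine Fintype.sum_equiv ⟨Equiv.symm, Equiv.symm, fun _ => rfl, fun _ => rfl⟩ _ _ fun σ => ?_
  refine Fintype.prod_equiv σ _ _ fun i => ?_
  simp

theorem abs_genPer_scale (A : Matrix ι κ ℚ) (u : ι → ℚ) (v : κ → ℚ)
    (hu : ∀ i, |u i| = 1) (hv : ∀ j, |v j| = 1) :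
    |genPer (Matrix.of fun i j => u i * A i j * v j)| = |genPer A| := by
  have : genPer (Matrix.of fun i j => u i * A i j * v j)
      = (∏ i, u i) * (∏ j, v j) * genPer A := by
    unfold genPer
    rw [Finset.mul_sum]
    refine Finset.sum_congr rfl fun σ _ => ?_
    simp only [Matrix.of_apply, Finset.prod_mul_distrib]
    rw [Equiv.prod_comp σ v]
    ring
  rw [this, abs_mul, abs_mul, Finset.abs_prod, Finset.abs_prod]
  simp [hu, hv]

/-- The sub-matrix obtained by deleting row `a` and column `j`. -/
def minorAt (A : Matrix ι κ ℚ) (a : ι) (j : κ) : Matrix {i // i ≠ a} {k // k ≠ j} ℚ :=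
  A.submatrix Subtype.val Subtype.val

/-- Bijections sending `a` to `j` are bijections between the complements of `a` and `j`. -/
def equivFixing (a : ι) (j : κ) : {σ : ι ≃ κ // σ a = j} ≃ ({i // i ≠ a} ≃ {k // k ≠ j}) where
  toFun σ := σ.1.subtypeEquiv fun _ =>
    not_congr ⟨fun h => h ▸ σ.2, fun h => σ.1.injective (h.trans σ.2.symm)⟩
  invFun τ := ⟨((Equiv.optionSubtypeNe a).symm.trans τ.optionCongr).trans (Equiv.optionSubtypeNe j),
    by simp⟩
  left_inv σ := by
    obtain ⟨σ, rfl⟩ := σ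
    ext i
    by_cases h : i = a
    · subst h; simp
    · simp [Equiv.optionSubtypeNe_symm_of_ne h]
  right_inv τ := by
    ext ⟨i, hi⟩
    simp [Equiv.optionSubtypeNe_symm_of_ne hi]

theorem sum_fixing_eq (A : Matrix ι κ ℚ) (a : ι) (j : κ) :
    ∑ σ : ι ≃ κ with σ a = j, ∏ i ∈ Finset.univ.erase a, A i (σ i) = genPer (minorAt A a j) := by
  unfold genPer
  rw [Finset.sum_subtype (p := fun σ : ι ≃ κ => σ a = j) _ (by simp)]
  refine Fintype.sum_equiv (equivFixing a j) _ _ fun σ => ?_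
  rw [Finset.prod_subtype (p := fun i => i ≠ a) _ (by simp)]
  rfl

theorem genPer_expand (A : Matrix ι κ ℚ) (a : ι) :
    genPer A = ∑ j, A a j * genPer (minorAt A a j) := by
  simp_rw [← sum_fixing_eq, Finset.mul_sum]
  unfold genPer
  rw [← Finset.sum_fiberwise (s := Finset.univ) (g := fun σ : ι ≃ κ => σ a)]
  refine Finset.sum_congr rfl fun j _ => Finset.sum_congr rfl fun σ hσ => ?_
  rw [← Finset.mul_prod_erase _ _ (Finset.mem_univ a), (Finset.mem_filter.1 hσ).2]

theorem abs_genPer_le (A : Matrix ι κ ℚ) (hA : ∀ i j, |A i j| = 1)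
    (h : Fintype.card ι = Fintype.card κ) : |genPer A| ≤ (Fintype.card ι).factorial := by
  unfold genPer
  refine (Finset.abs_sum_le_sum_abs _ _).trans ?_
  simp_rw [Finset.abs_prod, hA]
  simp [Fintype.card_equiv (Fintype.equivOfCardEq h)]

/-- The sub-matrix obtained by deleting rows `a`, `b` and columns `j`, `k`. -/
def minorAt₂ (A : Matrix ι κ ℚ) (a b : ι) (j k : κ) :
    Matrix {i // i ≠ a ∧ i ≠ b} {l // l ≠ j ∧ l ≠ k} ℚ :=
  A.submatrix Subtype.val Subtype.val

theorem genPer_minorAt₂_comm (A : Matrix ι κ ℚ) (a b : ι) (j k : κ) :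
    genPer (minorAt₂ A a b j k) = genPer (minorAt₂ A a b k j) := by
  rw [← genPer_submatrix_equiv (minorAt₂ A a b k j) (Equiv.refl _)
    (Equiv.subtypeEquivRight fun l => and_comm)]
  rfl

/-- Removing two points one after the other. -/
def subtypeNeNe {α : Type} (a : α) (b : {x // x ≠ a}) :
    {x : {x // x ≠ a} // x ≠ b} ≃ {x // x ≠ a ∧ x ≠ b.1} where
  toFun x := ⟨x.1.1, x.1.2, fun h => x.2 (Subtype.ext h)⟩
  invFun x := ⟨⟨x.1, x.2.1⟩, fun h => x.2.2 (congrArg Subtype.val h)⟩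
  left_inv _ := rfl
  right_inv _ := rfl

theorem genPer_expand₂ (A : Matrix ι κ ℚ) {a b : ι} (hab : a ≠ b) :
    genPer A = ∑ p ∈ (Finset.univ : Finset κ).offDiag,
      A a p.1 * A b p.2 * genPer (minorAt₂ A a b p.1 p.2) := by
  rw [genPer_expand A a]
  have key : ∀ j, A a j * genPer (minorAt A a j) =
      ∑ k ∈ Finset.univ.filter (fun k => k ≠ j),
        A a j * A b k * genPer (minorAt₂ A a b j k) := by
    intro j
    rw [genPer_expand (minorAt A a j) ⟨b, hab.symm⟩, Finset.mul_sum,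
      Finset.sum_subtype (p := fun k => k ≠ j) _ (by simp)]
    refine Finset.sum_congr rfl fun k _ => ?_
    rw [← genPer_submatrix_equiv (minorAt₂ A a b j k) (subtypeNeNe a ⟨b, hab.symm⟩)
      (subtypeNeNe j k), mul_assoc]
    rfl
  simp_rw [key]
  rw [Finset.sum_sigma']
  refine Finset.sum_bij' (fun x _ => (x.1, x.2)) (fun p _ => ⟨p.1, p.2⟩) ?_ ?_ ?_ ?_ ?_ <;>
    simp [eq_comm]

theorem abs_genPer_le_sum_offDiag (A : Matrix ι κ ℚ) (hA : ∀ i j, A i j = 1 ∨ A i j = -1)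
    {a b : ι} (hab : a ≠ b) :
    |genPer A| ≤ ∑ p ∈ (Finset.univ : Finset κ).offDiag with
      (A a p.1 = A b p.1 ↔ A a p.2 = A b p.2), |genPer (minorAt₂ A a b p.1 p.2)| := by
  have h1 := genPer_expand₂ A hab
  have h2 : genPer A = ∑ p ∈ (Finset.univ : Finset κ).offDiag,
      A a p.2 * A b p.1 * genPer (minorAt₂ A a b p.1 p.2) := by
    rw [h1]
    refine Finset.sum_bij' (fun p _ => p.swap) (fun p _ => p.swap) ?_ ?_ ?_ ?_ ?_
    · simp [eq_comm]
    · simp [eq_comm]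
    · simp
    · simp
    · intro p _
      simp [genPer_minorAt₂_comm A a b p.1 p.2]
  have h3 : 2 * genPer A = ∑ p ∈ (Finset.univ : Finset κ).offDiag,
      (A a p.1 * A b p.2 + A a p.2 * A b p.1) * genPer (minorAt₂ A a b p.1 p.2) := by
    simp_rw [add_mul, Finset.sum_add_distrib]
    linarith
  have h4 : 2 * |genPer A| ≤ 2 * ∑ p ∈ (Finset.univ : Finset κ).offDiag with
      (A a p.1 = A b p.1 ↔ A a p.2 = A b p.2), |genPer (minorAt₂ A a b p.1 p.2)| := by
    rw [← abs_two, ← abs_mul, h3, Finset.sum_filter, abs_two, Finset.mul_sum]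
    refine (Finset.abs_sum_le_sum_abs _ _).trans (Finset.sum_le_sum fun p _ => ?_)
    rw [abs_mul]
    rcases hA a p.1 with h | h <;> rcases hA a p.2 with h' | h' <;>
      rcases hA b p.1 with h'' | h'' <;> rcases hA b p.2 with h''' | h''' <;>
      norm_num [h, h', h'', h''']
  linarith

end genPer

/-- `diagPer a r` is the permanent of the square matrix of size `a + r` with `-1` in `r` diagonal
positions and `1` elsewhere. -/
def diagPer : ℕ → ℕ → ℚ
  | a, 0 => a.factorial
  | a, r + 1 => diagPer (a + 1) r - 2 * diagPer a r

/-- The matrix with `-1` in the diagonal positions belonging to `T` and `1` elsewhere. -/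
def signDiag {κ : Type} [DecidableEq κ] (T : Finset κ) : Matrix κ κ ℚ :=
  Matrix.of fun i j => if i = j ∧ j ∈ T then -1 else 1

theorem genPer_signDiag (t : ℕ) : ∀ (a : ℕ) {κ : Type} [Fintype κ] [DecidableEq κ] (T : Finset κ),
    T.card = t → Fintype.card κ = a + t → genPer (signDiag T) = diagPer a t := by
  induction t with
  | zero =>
    intro a κ _ _ T hT hκ
    obtain rfl := Finset.card_eq_zero.1 hT
    simp only [genPer, signDiag, diagPer]
    simp [Fintype.card_equiv (Equiv.refl κ), hκ]
  | succ t ih =>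
    intro a κ _ _ T hT hκ
    obtain ⟨x, T', hx, rfl, hT'⟩ := Finset.card_eq_succ.1 hT
    have hminor : ∀ j, minorAt (signDiag (insert x T')) x j = minorAt (signDiag T') x j := by
      intro j
      ext ⟨i, hi⟩ ⟨k, hk⟩
      simp only [minorAt, signDiag, Matrix.submatrix_apply, Matrix.of_apply, Finset.mem_insert]
      refine if_congr ?_ rfl rfl
      constructor
      · rintro ⟨rfl, h | h⟩
        · exact absurd h hi
        · exact ⟨rfl, h⟩
      · rintro ⟨rfl, h⟩
        exact ⟨rfl, Or.inr h⟩
    have hsub : minorAt (signDiag T') x x = signDiag (T'.subtype fun i => i ≠ x) := by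
      ext ⟨i, hi⟩ ⟨k, hk⟩
      simp [minorAt, signDiag]
    have hcard : (T'.subtype fun i => i ≠ x).card = t := by
      rw [Finset.card_subtype, Finset.filter_true_of_mem, hT']
      rintro i hi rfl
      exact hx hi
    have hcomp : Fintype.card {i // i ≠ x} = a + t := by
      rw [Fintype.card_subtype_compl, Fintype.card_subtype_eq, hκ]
      rfl
    rw [diagPer, ← ih (a + 1) T' hT' (by omega), ← ih a _ hcard hcomp, ← hsub,
      genPer_expand _ x, genPer_expand (signDiag T') x, sub_eq_add_neg, ← sub_eq_iff_eq_add',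
      ← Finset.sum_sub_distrib]
    simp_rw [hminor, ← sub_mul]
    rw [Finset.sum_eq_single x]
    · simp [signDiag, hx]
      ring
    · intro j _ hj
      simp [signDiag, hj.symm]
    · simp

theorem diagPer_expand (r : ℕ) : ∀ a, diagPer (a + 1) (r + 1) =
    (r + 1) * diagPer (a + 1) r + (a + 1) * diagPer a (r + 1) := by
  induction r with
  | zero =>
    intro a
    simp only [diagPer, Nat.factorial_succ]
    push_cast
    ring
  | succ r ih =>
    intro a
    have h1 := ih a
    have h2 := ih (a + 1)
    simp only [diagPer] at *
    push_cast at *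
    linarith

theorem diagPer_one_bounds (r : ℕ) :
    0 ≤ diagPer 0 (r + 4) ∧ 2 * diagPer 0 (r + 4) ≤ diagPer 1 (r + 4) := by
  induction r with
  | zero => norm_num [diagPer, Nat.factorial]
  | succ r ih =>
    have h1 : diagPer 0 (r + 4 + 1) = diagPer 1 (r + 4) - 2 * diagPer 0 (r + 4) := rfl
    have h2 := diagPer_expand (r + 4) 0
    rw [show r + 1 + 4 = r + 4 + 1 by ring]
    simp only [zero_add] at h2
    push_cast at h2
    have h3 : 0 ≤ (r : ℚ) * diagPer 1 (r + 4) := mul_nonneg (by positivity) (by linarith)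
    constructor <;> linarith

theorem diagPer_nonneg (a r : ℕ) : 0 ≤ diagPer (a + 1) r := by
  induction a generalizing r with
  | zero =>
    by_cases h : r < 4
    · interval_cases r <;> norm_num [diagPer, Nat.factorial]
    · obtain ⟨s, rfl⟩ := Nat.exists_eq_add_of_le' (not_lt.1 h)
      have := diagPer_one_bounds s
      rw [zero_add]
      linarith
  | succ a ih =>
    induction r with
    | zero => simp only [diagPer]; positivity
    | succ r ihr =>
      rw [diagPer_expand]
      have := ih (r + 1)
      positivity

theorem diagPer_antitone (a r k : ℕ) : diagPer (a + 1) (r + k) ≤ diagPer (a + 1 + k) r := by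
  induction k generalizing a with
  | zero => simp
  | succ k ih =>
    have h1 : diagPer (a + 1) (r + k + 1) =
        diagPer (a + 1 + 1) (r + k) - 2 * diagPer (a + 1) (r + k) :=
      rfl
    have h2 := ih (a + 1)
    have h3 := diagPer_nonneg a (r + k)
    rw [show a + 1 + (k + 1) = a + 1 + 1 + k by ring, ← add_assoc r]
    linarith

section spanDim

variable {α V : Type} [AddCommGroup V] [Module ℚ V] [FiniteDimensional ℚ V]

/-- The dimension of the span of the vectors `v i` for `i ∈ S`. -/
noncomputable def spanDim (v : α → V) (S : Set α) : ℕ :=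
  Module.finrank ℚ (Submodule.span ℚ (v '' S))

theorem spanDim_mono (v : α → V) {S T : Set α} (h : S ⊆ T) : spanDim v S ≤ spanDim v T :=
  Submodule.finrank_mono (Submodule.span_mono (Set.image_mono h))

theorem spanDim_le_diff_add_one (v : α → V) (S : Set α) (i : α) :
    spanDim v S ≤ spanDim v (S \ {i}) + 1 := by
  have h : Submodule.span ℚ (v '' S) ≤
      Submodule.span ℚ (v '' (S \ {i})) ⊔ Submodule.span ℚ {v i} := by
    rw [← Submodule.span_union, ← Set.image_singleton, ← Set.image_union]
    exact Submodule.span_mono (Set.image_mono (by simp))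
  refine (Submodule.finrank_mono h).trans
    ((Submodule.finrank_add_le_finrank_add_finrank _ _).trans ?_)
  exact Nat.add_le_add_left ((finrank_span_le_card _).trans (by simp)) _

theorem spanDim_compl_of_mem (v : α → V) {i : α}
    (h : v i ∈ Submodule.span ℚ (v '' {i}ᶜ)) : spanDim v {i}ᶜ = spanDim v Set.univ := by
  refine le_antisymm (spanDim_mono v (Set.subset_univ _)) (Submodule.finrank_mono ?_)
  rw [Submodule.span_le]
  rintro _ ⟨k, -, rfl⟩
  by_cases hk : k = i
  · exact hk ▸ h
  · exact Submodule.subset_span ⟨k, hk, rfl⟩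

theorem card_add_spanDim_compl_le (v : α → V) (T : Finset α)
    (hT : ∀ i ∈ T, v i ∉ Submodule.span ℚ (v '' {i}ᶜ)) :
    T.card + spanDim v (T : Set α)ᶜ ≤ spanDim v Set.univ := by
  classical
  induction T using Finset.induction_on with
  | empty => simp
  | insert i T hi ih =>
    have h1 := ih fun k hk => hT k (Finset.mem_insert_of_mem hk)
    have h2 : spanDim v ((insert i T : Finset α) : Set α)ᶜ < spanDim v (T : Set α)ᶜ := by
      refine Submodule.finrank_lt_finrank_of_lt (lt_of_le_of_ne
        (Submodule.span_mono (Set.image_mono (by simp))) fun h => ?_)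
      refine hT i (Finset.mem_insert_self i T) ?_
      have h3 : v i ∈ Submodule.span ℚ (v '' (T : Set α)ᶜ) :=
        Submodule.subset_span ⟨i, by simpa using hi, rfl⟩
      rw [← h] at h3
      exact Submodule.span_mono (Set.image_mono (by simp)) h3
    rw [Finset.card_insert_of_notMem hi]
    omega

/-- Vectors spanning at most a line are multiples of each nonzero one among them. -/
theorem exists_smul_of_spanDim_le_one (v : α → V) {S : Set α} (hS : spanDim v S ≤ 1) {i j : α}
    (hi : i ∈ S) (hj : j ∈ S) (h0 : v i ≠ 0) : ∃ c : ℚ, v j = c • v i := by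
  have h1 : Submodule.span ℚ {v i} ≤ Submodule.span ℚ (v '' S) :=
    Submodule.span_mono (by simpa using ⟨i, hi, rfl⟩)
  have h2 := Submodule.eq_of_le_of_finrank_le h1 (by rw [finrank_span_singleton h0]; exact hS)
  have h3 : v j ∈ Submodule.span ℚ (v '' S) := Submodule.subset_span ⟨j, hj, rfl⟩
  rw [← h2, Submodule.mem_span_singleton] at h3
  exact h3.imp fun c hc => hc.symm

theorem one_le_spanDim (v : α → V) {S : Set α} {i : α} (hi : i ∈ S) (h0 : v i ≠ 0) :
    1 ≤ spanDim v S := by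
  rw [← finrank_span_singleton (K := ℚ) h0]
  exact Submodule.finrank_mono (Submodule.span_mono (by simpa using ⟨i, hi, rfl⟩))

end spanDim

section rank

variable {ι κ : Type}

theorem rank_submatrix_col_eq_spanDim [Fintype ι] [Fintype κ] (A : Matrix ι κ ℚ)
    (p : κ → Prop) [Fintype {k // p k}] :
    (A.submatrix id (Subtype.val : {k // p k} → κ)).rank = spanDim A.col {k | p k} := by
  rw [Matrix.rank_eq_finrank_span_cols, spanDim, ← Subtype.range_coe_subtype, ← Set.range_comp]
  rfl

theorem rank_eq_spanDim_col [Fintype ι] [Fintype κ] (A : Matrix ι κ ℚ) :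
    A.rank = spanDim A.col Set.univ := by
  rw [Matrix.rank_eq_finrank_span_cols, spanDim, Set.image_univ]

theorem rank_eq_spanDim_row [Fintype ι] [Fintype κ] (A : Matrix ι κ ℚ) :
    A.rank = spanDim A.row Set.univ := by
  rw [Matrix.rank_eq_finrank_span_row, spanDim, Set.image_univ]

theorem rank_submatrix_row_eq_spanDim [Fintype ι] [Fintype κ] (A : Matrix ι κ ℚ)
    (p : ι → Prop) [Fintype {k // p k}] :
    (A.submatrix (Subtype.val : {k // p k} → ι) id).rank = spanDim A.row {k | p k} := by
  rw [← Matrix.rank_transpose]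
  exact rank_submatrix_col_eq_spanDim Aᵀ p

end rank

/-- `b` bounds the permanents of all `(-1,1)`-matrices of order `n` and rank at least `k`. -/
def PermBound (n k : ℕ) (b : ℚ) : Prop :=
  ∀ {ι κ : Type} [Fintype ι] [DecidableEq ι] [Fintype κ] [DecidableEq κ] (A : Matrix ι κ ℚ),
    Fintype.card ι = n → Fintype.card κ = n → (∀ i j, A i j = 1 ∨ A i j = -1) →
    k ≤ A.rank → |genPer A| ≤ b

theorem permBound_factorial (n k : ℕ) : PermBound n k n.factorial := by
  intro ι κ _ _ _ _ A hι hκ hA _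
  rw [← hι]
  refine abs_genPer_le A (fun i j => ?_) (hι.trans hκ.symm)
  rcases hA i j with h | h <;> simp [h]

theorem card_ne {α : Type} [Fintype α] [DecidableEq α] {n : ℕ} (x : α)
    (hα : Fintype.card α = n + 1) : Fintype.card {y // y ≠ x} = n := by
  rw [Fintype.card_subtype_compl, Fintype.card_subtype_eq, hα]
  rfl

theorem card_ne_ne {α : Type} [Fintype α] [DecidableEq α] {n : ℕ} {x y : α} (hxy : x ≠ y)
    (hα : Fintype.card α = n + 2) : Fintype.card {z // z ≠ x ∧ z ≠ y} = n := by
  have : (Finset.univ.filter fun z : α => z ≠ x ∧ z ≠ y) = ({x, y} : Finset α)ᶜ := by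
    ext z
    simp
  rw [Fintype.card_subtype, this, Finset.card_compl, Finset.card_pair hxy, hα]
  rfl

section bounds

variable {ι κ : Type} [Fintype ι] [DecidableEq ι] [Fintype κ] [DecidableEq κ]

/-- The columns of `A` outside the span of the remaining columns. -/
noncomputable def colCoreSet (A : Matrix ι κ ℚ) : Finset κ := by
  classical
  exact Finset.univ.filter fun j => A.col j ∉ Submodule.span ℚ (A.col '' {j}ᶜ)

omit [Fintype ι] [DecidableEq ι] [DecidableEq κ] in
theorem mem_colCoreSet (A : Matrix ι κ ℚ) (j : κ) :
    j ∈ colCoreSet A ↔ A.col j ∉ Submodule.span ℚ (A.col '' {j}ᶜ) := by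
  simp [colCoreSet]

omit [DecidableEq ι] [DecidableEq κ] in
theorem card_colCoreSet_add_le (A : Matrix ι κ ℚ) :
    (colCoreSet A).card + spanDim A.col (colCoreSet A : Set κ)ᶜ ≤ A.rank := by
  rw [rank_eq_spanDim_col]
  exact card_add_spanDim_compl_le _ _ fun j hj => (mem_colCoreSet A j).1 hj

omit [Fintype ι] [DecidableEq ι] [Fintype κ] [DecidableEq κ] in
theorem col_ne_zero (A : Matrix ι κ ℚ) (hA : ∀ i j, A i j = 1 ∨ A i j = -1) [Nonempty ι] (j : κ) :
    A.col j ≠ 0 := by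
  intro h
  have := congrFun h (Classical.arbitrary ι)
  rcases hA (Classical.arbitrary ι) j with h' | h' <;> simp [h'] at this

omit [DecidableEq ι] in
theorem card_colCoreSet_lt (A : Matrix ι κ ℚ) (hA : ∀ i j, A i j = 1 ∨ A i j = -1) [Nonempty ι]
    (h : A.rank < Fintype.card κ) : (colCoreSet A).card < A.rank := by
  have h1 := card_colCoreSet_add_le A
  obtain ⟨j, hj⟩ : ∃ j, j ∉ colCoreSet A := by
    by_contra! hall
    rw [Finset.eq_univ_iff_forall.2 hall, Finset.card_univ] at h1
    omega
  have h2 := one_le_spanDim A.col (S := (colCoreSet A : Set κ)ᶜ) (by simpa using hj)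
    (col_ne_zero A hA j)
  omega

omit [DecidableEq ι] [DecidableEq κ] in
theorem exists_row_mem_span (A : Matrix ι κ ℚ) (h : A.rank < Fintype.card ι) :
    ∃ a, A.row a ∈ Submodule.span ℚ (A.row '' {a}ᶜ) := by
  by_contra! hall
  have := card_add_spanDim_compl_le A.row Finset.univ fun a _ => hall a
  rw [Finset.card_univ, ← rank_eq_spanDim_row] at this
  omega

omit [DecidableEq κ] in
theorem rank_deleteRow_of_mem_span (A : Matrix ι κ ℚ) {a : ι}
    (ha : A.row a ∈ Submodule.span ℚ (A.row '' {a}ᶜ)) :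
    (A.submatrix (Subtype.val : {i // i ≠ a} → ι) id).rank = A.rank := by
  rw [rank_submatrix_row_eq_spanDim, rank_eq_spanDim_row]
  exact spanDim_compl_of_mem _ ha

theorem abs_genPer_le_of_rank_lt (A : Matrix ι κ ℚ) (hA : ∀ i j, A i j = 1 ∨ A i j = -1)
    {n r : ℕ} (hι : Fintype.card ι = n + 1) (hκ : Fintype.card κ = n + 1) (hr : A.rank = r + 1)
    (hrn : r < n) {b₁ b₂ : ℚ} (h₁ : PermBound n r b₁) (h₂ : PermBound n (r + 1) b₂)
    (hb : b₂ ≤ b₁) : |genPer A| ≤ r * b₁ + (n + 1 - r) * b₂ := by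
  obtain ⟨a, ha⟩ := exists_row_mem_span A (by omega)
  set B := A.submatrix (Subtype.val : {i // i ≠ a} → ι) id with hB
  have hBr : B.rank = r + 1 := by rw [hB, rank_deleteRow_of_mem_span A ha, hr]
  have : Nonempty {i // i ≠ a} := Fintype.card_pos_iff.1 (by rw [card_ne a hι]; omega)
  have hBA : ∀ i j, B i j = 1 ∨ B i j = -1 := fun i j => hA _ _
  have hC := card_colCoreSet_lt B hBA (by omega)
  have hrank : ∀ j, (minorAt A a j).rank = spanDim B.col {j}ᶜ := fun j =>
    rank_submatrix_col_eq_spanDim B fun k => k ≠ j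
  have hle : ∀ j, |genPer (minorAt A a j)| ≤ if j ∈ colCoreSet B then b₁ else b₂ := by
    intro j
    split_ifs with hj
    · refine h₁ _ (card_ne a hι) (card_ne j hκ) (fun _ _ => hA _ _) ?_
      have := spanDim_le_diff_add_one B.col Set.univ j
      rw [← rank_eq_spanDim_col, ← Set.compl_eq_univ_sdiff] at this
      rw [hrank]
      omega
    · refine h₂ _ (card_ne a hι) (card_ne j hκ) (fun _ _ => hA _ _) ?_
      rw [mem_colCoreSet, not_not] at hj
      rw [hrank, spanDim_compl_of_mem _ hj, ← rank_eq_spanDim_col, hBr]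
  rw [genPer_expand A a]
  have hsum : |∑ j, A a j * genPer (minorAt A a j)| ≤
      ∑ j, if j ∈ colCoreSet B then b₁ else b₂ := by
    refine (Finset.abs_sum_le_sum_abs _ _).trans (Finset.sum_le_sum fun j _ => ?_)
    rw [abs_mul]
    rcases hA a j with h | h <;> simpa [h] using hle j
  refine hsum.trans ?_
  have hsplit : ∀ j, (if j ∈ colCoreSet B then b₁ else b₂) =
      (if j ∈ colCoreSet B then b₁ - b₂ else 0) + b₂ := fun j => by split_ifs <;> ring
  simp_rw [hsplit]
  rw [Finset.sum_add_distrib, Finset.sum_ite_mem]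
  simp only [Finset.univ_inter, Finset.sum_const, Finset.card_univ, hκ, nsmul_eq_mul]
  have : ((colCoreSet B).card : ℚ) ≤ r := by exact_mod_cast (by omega : (colCoreSet B).card ≤ r)
  push_cast
  nlinarith

/-- The pairs of distinct columns for which rows `a`, `b` agree on both or differ on both. -/
def agreePairs (A : Matrix ι κ ℚ) (a b : ι) : Finset (κ × κ) :=
  {p ∈ (Finset.univ : Finset κ).offDiag | A a p.1 = A b p.1 ↔ A a p.2 = A b p.2}

/-- The columns on which rows `a` and `b` differ. -/
def diffCols (A : Matrix ι κ ℚ) (a b : ι) : Finset κ := {j | A a j ≠ A b j}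

omit [Fintype ι] [DecidableEq ι] in
theorem card_agreePairs_le (A : Matrix ι κ ℚ) (a b : ι) {s t : ℕ} (hs : (diffCols A a b).card = s)
    (ht : s + t = Fintype.card κ) :
    ((agreePairs A a b).card : ℚ) ≤ s * (s - 1) + t * (t - 1) := by
  have hsub : agreePairs A a b ⊆ (diffCols A a b).offDiag ∪ (diffCols A a b)ᶜ.offDiag := by
    intro p hp
    simp only [agreePairs, diffCols, Finset.mem_filter, Finset.mem_offDiag, Finset.mem_union,
      Finset.mem_compl, Finset.mem_univ, true_and] at hp ⊢
    tauto
  have h1 := (Finset.card_le_card hsub).trans (Finset.card_union_le _ _)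
  have h2 : (diffCols A a b)ᶜ.card = t := by rw [Finset.card_compl]; omega
  rw [Finset.offDiag_card, Finset.offDiag_card, h2, hs] at h1
  have h3 : ((agreePairs A a b).card : ℚ) ≤ ((s * s - s + (t * t - t) : ℕ) : ℚ) := by
    exact_mod_cast h1
  rw [Nat.cast_add, Nat.cast_sub (Nat.le_mul_self s), Nat.cast_sub (Nat.le_mul_self t)] at h3
  push_cast at h3
  linarith

theorem abs_genPer_le_card_agreePairs (A : Matrix ι κ ℚ) (hA : ∀ i j, A i j = 1 ∨ A i j = -1)
    {m : ℕ} (hι : Fintype.card ι = m + 2) (hκ : Fintype.card κ = m + 2) {a b : ι} (hab : a ≠ b)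
    {B : Matrix {i // i ≠ a ∧ i ≠ b} κ ℚ} (hB : B = A.submatrix Subtype.val id) {k : ℕ}
    (hk : B.rank = k + 2)
    {b₁ b₂ : ℚ} (h₁ : PermBound m (k + 1) b₁) (h₂ : PermBound m k b₂) :
    |genPer A| ≤ (agreePairs A a b).card * b₁ +
      {p ∈ agreePairs A a b | p.1 ∈ colCoreSet B ∧ p.2 ∈ colCoreSet B}.card * (b₂ - b₁) := by
  have hrank : ∀ j l, (minorAt₂ A a b j l).rank = spanDim B.col ({j}ᶜ \ {l}) := by
    intro j l
    rw [hB]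
    refine (rank_submatrix_col_eq_spanDim (A.submatrix (Subtype.val : {i // i ≠ a ∧ i ≠ b} → ι) id)
      fun k => k ≠ j ∧ k ≠ l).trans ?_
    rfl
  have hB0 : spanDim B.col Set.univ = k + 2 := by rw [← rank_eq_spanDim_col, hk]
  have hdel : ∀ j l, k ≤ spanDim B.col ({j}ᶜ \ {l}) ∧
      (j ∉ colCoreSet B → k + 1 ≤ spanDim B.col ({j}ᶜ \ {l})) := by
    intro j l
    have h1 := spanDim_le_diff_add_one B.col Set.univ j
    have h2 := spanDim_le_diff_add_one B.col {j}ᶜ l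
    rw [← Set.compl_eq_univ_sdiff] at h1
    refine ⟨by omega, fun hj => ?_⟩
    rw [mem_colCoreSet, not_not] at hj
    have := spanDim_compl_of_mem _ hj
    omega
  have hle : ∀ p ∈ agreePairs A a b, |genPer (minorAt₂ A a b p.1 p.2)| ≤
      b₁ + if p.1 ∈ colCoreSet B ∧ p.2 ∈ colCoreSet B then b₂ - b₁ else 0 := by
    intro p hp
    have hne : p.1 ≠ p.2 := by
      simp only [agreePairs, Finset.mem_filter, Finset.mem_offDiag] at hp
      tauto
    split_ifs with hj
    · rw [add_sub_cancel]
      refine h₂ _ (card_ne_ne hab hι) (card_ne_ne hne hκ) (fun _ _ => hA _ _) ?_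
      rw [hrank]
      exact (hdel _ _).1
    · rw [add_zero]
      rw [not_and_or] at hj
      rcases hj with hj | hj
      · refine h₁ _ (card_ne_ne hab hι) (card_ne_ne hne hκ) (fun _ _ => hA _ _) ?_
        rw [hrank]
        exact (hdel _ _).2 hj
      · rw [genPer_minorAt₂_comm]
        refine h₁ _ (card_ne_ne hab hι) (card_ne_ne hne.symm hκ) (fun _ _ => hA _ _) ?_
        rw [hrank]
        exact (hdel _ _).2 hj
  refine (abs_genPer_le_sum_offDiag A hA hab).trans ((Finset.sum_le_sum hle).trans ?_)
  rw [Finset.sum_add_distrib, ← Finset.sum_filter]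
  simp only [Finset.sum_const, nsmul_eq_mul, le_refl]

end bounds

section smallOrder

variable {ι κ : Type} [Fintype ι] [DecidableEq ι] [Fintype κ] [DecidableEq κ]

omit [DecidableEq ι] [DecidableEq κ] in
theorem rank_le_card_of_row_mem_span (A : Matrix ι κ ℚ) (T : Finset ι)
    (h : ∀ i, A.row i ∈ Submodule.span ℚ (A.row '' T)) : A.rank ≤ T.card := by
  classical
  rw [Matrix.rank_eq_finrank_span_row]
  have h1 : Submodule.span ℚ (Set.range A.row) ≤ Submodule.span ℚ (A.row '' T) := by
    rw [Submodule.span_le]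
    rintro _ ⟨i, rfl⟩
    exact h i
  refine (Submodule.finrank_mono h1).trans ?_
  rw [← Finset.coe_image]
  exact (finrank_span_finset_le_card _).trans Finset.card_image_le

omit [Fintype ι] [DecidableEq ι] [DecidableEq κ] in
theorem row_mem_span_of_card_diffCols (A : Matrix ι κ ℚ) (hA : ∀ i j, A i j = 1 ∨ A i j = -1)
    {a b : ι} (h : ¬(0 < (diffCols A a b).card ∧ (diffCols A a b).card < Fintype.card κ)) :
    A.row b ∈ Submodule.span ℚ {A.row a} := by
  rw [Submodule.mem_span_singleton]
  by_cases h0 : (diffCols A a b).card = 0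
  · refine ⟨1, ?_⟩
    rw [Finset.card_eq_zero, diffCols, Finset.filter_eq_empty_iff] at h0
    ext j
    have := h0 (Finset.mem_univ j)
    simpa using this
  · have h1 : (diffCols A a b).card = Fintype.card κ :=
      le_antisymm (Finset.card_le_univ _) (by omega)
    rw [Finset.card_eq_iff_eq_univ, Finset.eq_univ_iff_forall] at h1
    refine ⟨-1, ?_⟩
    ext j
    have := h1 j
    simp only [diffCols, Finset.mem_filter] at this
    rcases hA a j with h | h <;> rcases hA b j with h' | h' <;> simp_all

omit [DecidableEq ι] [DecidableEq κ] in
theorem exists_card_diffCols (A : Matrix ι κ ℚ) (hA : ∀ i j, A i j = 1 ∨ A i j = -1)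
    (h : 2 ≤ A.rank) (a : ι) :
    ∃ b, 0 < (diffCols A a b).card ∧ (diffCols A a b).card < Fintype.card κ := by
  by_contra! hall
  have := rank_le_card_of_row_mem_span A {a} fun i => by
    simpa using row_mem_span_of_card_diffCols A hA (a := a) (b := i)
      fun h => absurd (hall i h.1) (not_le.2 h.2)
  simp at this
  omega

omit [Fintype ι] [DecidableEq ι] in
theorem diffCols_symmDiff (A : Matrix ι κ ℚ) (hA : ∀ i j, A i j = 1 ∨ A i j = -1) (a b c : ι) :
    symmDiff (diffCols A a b) (diffCols A a c) = diffCols A b c := by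
  ext j
  simp only [diffCols, Finset.mem_symmDiff, Finset.mem_filter, Finset.mem_univ, true_and]
  rcases hA a j with h | h <;> rcases hA b j with h' | h' <;> rcases hA c j with h'' | h'' <;>
    norm_num [h, h', h'']

omit [Fintype κ] in
theorem card_symmDiff_add (s t : Finset κ) :
    (symmDiff s t).card + 2 * (s ∩ t).card = s.card + t.card := by
  have h1 : (symmDiff s t).card = (s \ t).card + (t \ s).card :=
    Finset.card_union_of_disjoint disjoint_sdiff_sdiff
  have h2 := Finset.card_sdiff_add_card_inter s t
  have h3 := Finset.card_sdiff_add_card_inter t s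
  rw [Finset.inter_comm t s] at h3
  omega

theorem exists_two_le_card_diffCols (A : Matrix ι κ ℚ) (hA : ∀ i j, A i j = 1 ∨ A i j = -1)
    (hκ : 4 ≤ Fintype.card κ) (h : 3 ≤ A.rank) :
    ∃ a b, 2 ≤ (diffCols A a b).card ∧ (diffCols A a b).card + 2 ≤ Fintype.card κ := by
  have : Nonempty ι := Fintype.card_pos_iff.1 (by have := A.rank_le_card_height; omega)
  obtain ⟨a⟩ := this
  obtain ⟨b, hb⟩ := exists_card_diffCols A hA (by omega) a
  obtain ⟨c, hac, hbc⟩ : ∃ c, (0 < (diffCols A a c).card ∧ (diffCols A a c).card < Fintype.card κ) ∧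
      (0 < (diffCols A b c).card ∧ (diffCols A b c).card < Fintype.card κ) := by
    by_contra! hall
    have := rank_le_card_of_row_mem_span A {a, b} fun i => by
      by_cases hi : 0 < (diffCols A a i).card ∧ (diffCols A a i).card < Fintype.card κ
      · refine Submodule.span_mono ?_ (row_mem_span_of_card_diffCols A hA (a := b) (b := i)
          fun h => absurd (hall i hi h.1) (not_le.2 h.2))
        simp
      · refine Submodule.span_mono ?_ (row_mem_span_of_card_diffCols A hA (a := a) (b := i) hi)
        simp
    have := Finset.card_le_two (a := a) (b := b)
    omega
  by_contra! hall
  have h1 := hall a b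
  have h2 := hall a c
  have h3 := hall b c
  have h4 := card_symmDiff_add (diffCols A a b) (diffCols A a c)
  have h5 := Finset.card_union_add_card_inter (diffCols A a b) (diffCols A a c)
  have h6 := Finset.card_le_univ (diffCols A a b ∪ diffCols A a c)
  have h8 := Finset.card_le_card
    (Finset.inter_subset_left (s₁ := diffCols A a b) (s₂ := diffCols A a c))
  have h7 := Finset.card_le_card
    (Finset.inter_subset_right (s₁ := diffCols A a b) (s₂ := diffCols A a c))
  rw [diffCols_symmDiff A hA] at h4
  omega

omit [Fintype ι] [DecidableEq ι] [DecidableEq κ] in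
theorem ne_of_card_diffCols_pos (A : Matrix ι κ ℚ) {a b : ι} (h : 0 < (diffCols A a b).card) :
    a ≠ b := by
  rintro rfl
  simp [diffCols] at h

theorem abs_genPer_le_mul_factorial (A : Matrix ι κ ℚ) (hA : ∀ i j, A i j = 1 ∨ A i j = -1)
    {m : ℕ} (hι : Fintype.card ι = m + 2) (hκ : Fintype.card κ = m + 2) {a b : ι} (hab : a ≠ b) :
    |genPer A| ≤ (agreePairs A a b).card * m.factorial := by
  refine (abs_genPer_le_sum_offDiag A hA hab).trans ((Finset.sum_le_sum fun p hp =>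
    permBound_factorial m 0 (minorAt₂ A a b p.1 p.2) (card_ne_ne hab hι) (card_ne_ne ?_ hκ)
      (fun _ _ => hA _ _) (Nat.zero_le _)).trans ?_)
  · simp only [Finset.mem_filter, Finset.mem_offDiag] at hp
    tauto
  · simp [agreePairs]

theorem permBound_three_two : PermBound 3 2 2 := by
  intro ι κ _ _ _ _ A hι hκ hA hr
  have : Nonempty ι := Fintype.card_pos_iff.1 (by omega)
  obtain ⟨b, hb1, hb2⟩ := exists_card_diffCols A hA hr (Classical.arbitrary ι)
  have h1 := abs_genPer_le_mul_factorial A hA hι hκ (ne_of_card_diffCols_pos A hb1)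
  refine h1.trans ?_
  generalize hs : (diffCols A (Classical.arbitrary ι) b).card = s at *
  have h2 := card_agreePairs_le A _ b hs (t := 3 - s) (by omega)
  obtain rfl | rfl : s = 1 ∨ s = 2 := by omega
  all_goals norm_num at h2 ⊢; exact h2

theorem permBound_four_two : PermBound 4 2 12 := by
  intro ι κ _ _ _ _ A hι hκ hA hr
  have : Nonempty ι := Fintype.card_pos_iff.1 (by omega)
  obtain ⟨b, hb1, hb2⟩ := exists_card_diffCols A hA hr (Classical.arbitrary ι)
  have h1 := abs_genPer_le_mul_factorial A hA hι hκ (ne_of_card_diffCols_pos A hb1)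
  refine h1.trans ?_
  generalize hs : (diffCols A (Classical.arbitrary ι) b).card = s at *
  have h2 := card_agreePairs_le A _ b hs (t := 4 - s) (by omega)
  obtain rfl | rfl | rfl : s = 1 ∨ s = 2 ∨ s = 3 := by omega
  all_goals norm_num at h2 ⊢; qify at h2; linarith

theorem permBound_four_three : PermBound 4 3 8 := by
  intro ι κ _ _ _ _ A hι hκ hA hr
  obtain ⟨a, b, hb1, hb2⟩ := exists_two_le_card_diffCols A hA (by omega) hr
  have h1 := abs_genPer_le_mul_factorial A hA hι hκ
    (ne_of_card_diffCols_pos A (zero_lt_two.trans_le hb1))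
  refine h1.trans ?_
  have h2 := card_agreePairs_le A a b (s := 2) (t := 2) (by omega) (by omega)
  norm_num at h2 ⊢
  qify at h2
  linarith

omit [DecidableEq κ] in
theorem rank_deleteRows_eq (A : Matrix ι κ ℚ) {m : ℕ} (hι : Fintype.card ι = m + 2) {a b : ι}
    (hab : a ≠ b) (h : m + 1 ≤ spanDim A.row {a}ᶜ) :
    (A.submatrix (Subtype.val : {i // i ≠ a ∧ i ≠ b} → ι) id).rank = m := by
  refine le_antisymm ((Matrix.rank_le_card_height _).trans_eq (card_ne_ne hab hι)) ?_
  rw [rank_submatrix_row_eq_spanDim]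
  have := spanDim_le_diff_add_one A.row {a}ᶜ b
  change m ≤ spanDim A.row ({a}ᶜ \ {b})
  omega

omit [DecidableEq ι] [DecidableEq κ] in
theorem le_spanDim_row_compl (A : Matrix ι κ ℚ) {n : ℕ} (h : A.rank = n + 1) (a : ι) :
    n ≤ spanDim A.row {a}ᶜ := by
  have := spanDim_le_diff_add_one A.row Set.univ a
  rw [← Set.compl_eq_univ_sdiff, ← rank_eq_spanDim_row] at this
  omega

theorem card_filter_mem_le (s : Finset (κ × κ)) (hs : s ⊆ Finset.univ.offDiag) {C : Finset κ}
    {c : ℕ} (hC : C.card ≤ c) :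
    ({p ∈ s | p.1 ∈ C ∧ p.2 ∈ C}.card : ℚ) ≤ c * (c - 1) := by
  have hsub : {p ∈ s | p.1 ∈ C ∧ p.2 ∈ C} ⊆ C.offDiag := by
    intro p hp
    rw [Finset.mem_filter] at hp
    have := hs hp.1
    rw [Finset.mem_offDiag] at this ⊢
    tauto
  have h1 := Finset.card_le_card hsub
  have h2 : C.card * (C.card - 1) ≤ c * (c - 1) := Nat.mul_le_mul hC (by omega)
  rw [Finset.offDiag_card, ← Nat.mul_sub_one] at h1
  have h3 : ({p ∈ s | p.1 ∈ C ∧ p.2 ∈ C}.card : ℚ) ≤ ((c * (c - 1) : ℕ) : ℚ) := by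
    exact_mod_cast h1.trans h2
  rw [Nat.mul_sub_one, Nat.cast_sub (Nat.le_mul_self c)] at h3
  push_cast at h3
  linarith

theorem abs_genPer_five_le (A : Matrix ι κ ℚ) (hA : ∀ i j, A i j = 1 ∨ A i j = -1)
    (hι : Fintype.card ι = 5) (hκ : Fintype.card κ = 5) {a b : ι} (hab : a ≠ b)
    (h : 4 ≤ spanDim A.row {a}ᶜ) : |genPer A| ≤ (agreePairs A a b).card * 2 + 8 := by
  have hr := rank_deleteRows_eq A hι hab h
  have h1 := abs_genPer_le_card_agreePairs A hA hι hκ hab rfl (k := 1) hr permBound_three_two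
    (permBound_factorial 3 1)
  have : Nonempty {i // i ≠ a ∧ i ≠ b} := Fintype.card_pos_iff.1 (by rw [card_ne_ne hab hι]; simp)
  have h2 := card_colCoreSet_lt (A.submatrix (Subtype.val : {i // i ≠ a ∧ i ≠ b} → ι) id)
    (fun _ _ => hA _ _) (by omega)
  have h3 := card_filter_mem_le (agreePairs A a b) (Finset.filter_subset _ _) (c := 2)
    (Nat.le_of_lt_succ (h2.trans_eq hr))
  norm_num [Nat.factorial] at h1 h3
  qify at h3
  linarith

theorem abs_genPer_five_le_of_rank_four (A : Matrix ι κ ℚ) (hA : ∀ i j, A i j = 1 ∨ A i j = -1)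
    (hι : Fintype.card ι = 5) (hκ : Fintype.card κ = 5) (hr : A.rank = 4) : |genPer A| ≤ 32 := by
  obtain ⟨a, ha⟩ := exists_row_mem_span A (by omega)
  obtain ⟨b, hb1, hb2⟩ := exists_card_diffCols A hA (by omega) a
  have h1 := abs_genPer_five_le A hA hι hκ (ne_of_card_diffCols_pos A hb1)
    (by rw [spanDim_compl_of_mem _ ha, ← rank_eq_spanDim_row, hr])
  generalize hs : (diffCols A a b).card = s at *
  have h2 := card_agreePairs_le A _ b hs (t := 5 - s) (by omega)
  obtain rfl | rfl | rfl | rfl : s = 1 ∨ s = 2 ∨ s = 3 ∨ s = 4 := by omega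
  all_goals norm_num at h2; qify at h2; linarith

theorem abs_genPer_five_le_of_rank_five (A : Matrix ι κ ℚ) (hA : ∀ i j, A i j = 1 ∨ A i j = -1)
    (hι : Fintype.card ι = 5) (hκ : Fintype.card κ = 5) (hr : A.rank = 5) : |genPer A| ≤ 24 := by
  obtain ⟨a, b, hb1, hb2⟩ := exists_two_le_card_diffCols A hA (by omega) (by omega)
  have h1 := abs_genPer_five_le A hA hι hκ (ne_of_card_diffCols_pos A (zero_lt_two.trans_le hb1))
    (le_spanDim_row_compl A hr a)
  generalize hs : (diffCols A a b).card = s at *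
  have h2 := card_agreePairs_le A _ b hs (t := 5 - s) (by omega)
  obtain rfl | rfl : s = 2 ∨ s = 3 := by omega
  all_goals norm_num at h2; qify at h2; linarith

end smallOrder

section fullRank

variable {ι κ : Type} [Fintype ι] [DecidableEq ι] [Fintype κ] [DecidableEq κ]

theorem diagPer_pair_expand (t : ℕ) : diagPer 1 (t + 5) + 4 * diagPer 1 (t + 2) =
    (2 + (t + 4) * (t + 3)) * diagPer 2 (t + 2) + (t + 3) * (t + 2) * (2 * diagPer 2 (t + 1)) := by
  have e1 := diagPer_expand (t + 4) 0
  have e2 := diagPer_expand (t + 3) 0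
  have e3 := diagPer_expand (t + 2) 0
  have e4 := diagPer_expand (t + 1) 1
  have f1 : diagPer 0 (t + 5) = diagPer 1 (t + 4) - 2 * diagPer 0 (t + 4) := rfl
  have f2 : diagPer 0 (t + 4) = diagPer 1 (t + 3) - 2 * diagPer 0 (t + 3) := rfl
  have f3 : diagPer 1 (t + 3) = diagPer 2 (t + 2) - 2 * diagPer 1 (t + 2) := rfl
  norm_num [add_assoc] at e1 e2 e3 e4
  linear_combination e1 + f1 + (t + 6) * e2 + (t + 4) * f2 + 2 * (t + 4) * e3 +
    (t + 4) * (t + 5) * f3 + 2 * (t + 3) * e4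

theorem pair_bound_numeric (t : ℕ) {N Z : ℚ} (hN : N ≤ 2 + (t + 4) * (t + 3))
    (hZ : Z ≤ (t + 3) * (t + 2))
    (h : N ≤ (t + 4) * (t + 3) ∨ Z ≤ (t + 3) * (t + 2) - 2) :
    N * diagPer 2 (t + 2) + Z * (diagPer 3 (t + 1) - diagPer 2 (t + 2)) ≤ diagPer 1 (t + 5) := by
  have e := diagPer_pair_expand t
  have f1 : diagPer 2 (t + 2) = diagPer 3 (t + 1) - 2 * diagPer 2 (t + 1) := rfl
  have f2 : diagPer 1 (t + 2) = diagPer 2 (t + 1) - 2 * diagPer 1 (t + 1) := rfl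
  have f3 : diagPer 1 (t + 3) = diagPer 2 (t + 2) - 2 * diagPer 1 (t + 2) := rfl
  have p1 := diagPer_nonneg 1 (t + 1)
  have p2 := diagPer_nonneg 1 (t + 2)
  have p3 := diagPer_nonneg 0 (t + 1)
  have p4 := diagPer_nonneg 0 (t + 3)
  norm_num at p1 p2 p3 p4
  have f1' : diagPer 3 (t + 1) - diagPer 2 (t + 2) = 2 * diagPer 2 (t + 1) := by linarith
  rw [f1']
  rcases h with h | h
  · have := mul_le_mul_of_nonneg_right h p2
    have := mul_le_mul_of_nonneg_right hZ p1
    linarith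
  · have := mul_le_mul_of_nonneg_right hN p2
    have := mul_le_mul_of_nonneg_right h p1
    linarith

omit [DecidableEq κ] in
theorem card_diffCols_of_full_rank (A : Matrix ι κ ℚ) (hA : ∀ i j, A i j = 1 ∨ A i j = -1)
    (hr : A.rank = Fintype.card ι) {a b : ι} (hab : a ≠ b) :
    0 < (diffCols A a b).card ∧ (diffCols A a b).card < Fintype.card κ := by
  by_contra h
  have h1 := row_mem_span_of_card_diffCols A hA h
  have h2 : A.row b ∈ Submodule.span ℚ (A.row '' {b}ᶜ) :=
    Submodule.span_mono (by simpa using ⟨a, hab, rfl⟩) h1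
  have h3 := rank_deleteRow_of_mem_span A h2
  have h4 := Matrix.rank_le_card_height (A.submatrix (Subtype.val : {i // i ≠ b} → ι) id)
  have h5 : 0 < Fintype.card ι := Fintype.card_pos_iff.2 ⟨a⟩
  have h6 := card_ne b (n := Fintype.card ι - 1) (by omega)
  omega

omit [Fintype κ] [DecidableEq κ] in
theorem exists_mul_eq_of_spanDim_le_one {ρ : Type} [Finite ρ] (B : Matrix ρ κ ℚ)
    (hB : ∀ i j, B i j = 1 ∨ B i j = -1) [Nonempty ρ] {S : Set κ} (hS : spanDim B.col S ≤ 1)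
    {j k : κ} (hj : j ∈ S) (hk : k ∈ S) : ∃ c : ℚ, |c| = 1 ∧ ∀ i, B i k = c * B i j := by
  obtain ⟨c, hc⟩ := exists_smul_of_spanDim_le_one B.col hS hj hk (col_ne_zero B hB j)
  have h : ∀ i, B i k = c * B i j := fun i => by simpa using congrFun hc i
  refine ⟨c, ?_, h⟩
  have habs : ∀ i j, |B i j| = 1 := fun i j => by rcases hB i j with h | h <;> simp [h]
  have := congrArg abs (h (Classical.arbitrary ρ))
  rwa [abs_mul, habs, habs, mul_one, eq_comm] at this

theorem abs_genPer_le_or_columns (t : ℕ) (h₁ : PermBound (t + 4) (t + 3) (diagPer 2 (t + 2)))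
    (h₂ : PermBound (t + 4) (t + 2) (diagPer 3 (t + 1)))
    (A : Matrix ι κ ℚ) (hA : ∀ i j, A i j = 1 ∨ A i j = -1)
    (hι : Fintype.card ι = t + 6) (hκ : Fintype.card κ = t + 6) (hr : A.rank = t + 6)
    {a b : ι} (hab : a ≠ b) (hs₁ : 2 ≤ (diffCols A a b).card)
    (hs₂ : (diffCols A a b).card + 2 ≤ t + 6) :
    |genPer A| ≤ diagPer 1 (t + 5) ∨
      ((diffCols A a b).card = 2 ∨ (diffCols A a b).card = t + 4) ∧
      ∃ C : Finset κ, C.card = t + 3 ∧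
        (∀ j ∈ C, ∀ k ∈ C, (j ∈ diffCols A a b ↔ k ∈ diffCols A a b)) ∧
        ∀ j ∉ C, ∀ k ∉ C, ∃ c : ℚ, |c| = 1 ∧ ∀ i, i ≠ a → i ≠ b → A i k = c * A i j := by
  have hrB := rank_deleteRows_eq A hι hab (le_spanDim_row_compl A hr a)
  have hmain := abs_genPer_le_card_agreePairs A hA hι hκ hab rfl (k := t + 2) hrB h₁ h₂
  set B := A.submatrix (Subtype.val : {i // i ≠ a ∧ i ≠ b} → ι) id with hB
  have hBA : ∀ i j, B i j = 1 ∨ B i j = -1 := fun i j => hA _ _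
  have : Nonempty {i // i ≠ a ∧ i ≠ b} := Fintype.card_pos_iff.1 (by rw [card_ne_ne hab hι]; omega)
  have hC := card_colCoreSet_lt B hBA (by omega)
  have hC' := card_colCoreSet_add_le B
  obtain ⟨s, hs⟩ : ∃ s, (diffCols A a b).card = s := ⟨_, rfl⟩
  obtain ⟨u, hu⟩ : ∃ u, s + u = t + 6 := ⟨t + 6 - s, by omega⟩
  have hN := card_agreePairs_le A a b hs (hu.trans hκ.symm)
  have hZ := card_filter_mem_le (agreePairs A a b) (Finset.filter_subset _ _) (C := colCoreSet B)
    (c := t + 3) (by omega)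
  rw [hs] at hs₁ hs₂ ⊢
  have hu' : (u : ℚ) = t + 6 - s := by
    rw [eq_sub_iff_add_eq']
    exact_mod_cast hu
  have q1 : (2 : ℚ) ≤ s := by exact_mod_cast hs₁
  have q2 : (2 : ℚ) ≤ u := by exact_mod_cast (by omega : 2 ≤ u)
  have hN0 : ((agreePairs A a b).card : ℚ) ≤ 2 + (t + 4) * (t + 3) := by
    nlinarith [mul_nonneg (sub_nonneg.2 q1) (sub_nonneg.2 q2)]
  have hZ0 : ({p ∈ agreePairs A a b | p.1 ∈ colCoreSet B ∧ p.2 ∈ colCoreSet B}.card : ℚ) ≤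
      (t + 3) * (t + 2) := by
    push_cast at hZ
    linarith
  by_cases hs3 : 3 ≤ s ∧ 3 ≤ u
  · left
    refine hmain.trans (pair_bound_numeric t hN0 hZ0 (Or.inl ?_))
    have q1 : (3 : ℚ) ≤ s := by exact_mod_cast hs3.1
    have q2 : (3 : ℚ) ≤ u := by exact_mod_cast hs3.2
    have q3 : (0 : ℚ) ≤ t := Nat.cast_nonneg t
    nlinarith [mul_nonneg (sub_nonneg.2 q1) (sub_nonneg.2 q2)]
  by_cases hZ2 : ({p ∈ agreePairs A a b | p.1 ∈ colCoreSet B ∧ p.2 ∈ colCoreSet B}.card : ℚ) ≤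
      (t + 3) * (t + 2) - 2
  · exact Or.inl (hmain.trans (pair_bound_numeric t hN0 hZ0 (Or.inr hZ2)))
  right
  refine ⟨by omega, colCoreSet B, ?_, ?_, ?_⟩
  · by_contra hne
    refine hZ2 ((card_filter_mem_le (agreePairs A a b) (Finset.filter_subset _ _)
      (C := colCoreSet B) (c := t + 2) (by omega)).trans ?_)
    push_cast
    have q3 : (0 : ℚ) ≤ t := Nat.cast_nonneg t
    nlinarith
  · by_contra! hjk
    obtain ⟨j, hj, k, hk, hjk⟩ := hjk
    have hne : j ≠ k := by
      rintro rfl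
      tauto
    refine hZ2 ?_
    have hsub : {p ∈ agreePairs A a b | p.1 ∈ colCoreSet B ∧ p.2 ∈ colCoreSet B} ⊆
        (colCoreSet B).offDiag \ {(j, k), (k, j)} := by
      rintro ⟨x, y⟩ hp
      simp only [agreePairs, Finset.mem_filter, Finset.mem_offDiag, Finset.mem_univ, true_and,
        diffCols, Finset.mem_sdiff, Finset.mem_insert, Finset.mem_singleton, Prod.mk.injEq]
        at hp hjk ⊢
      refine ⟨⟨hp.2.1, hp.2.2, hp.1.1⟩, ?_⟩
      rintro (⟨rfl, rfl⟩ | ⟨rfl, rfl⟩) <;> tauto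
    have h1 := Finset.card_le_card hsub
    have hpair : ({(j, k), (k, j)} : Finset (κ × κ)) ⊆ (colCoreSet B).offDiag := by
      intro p hp
      simp only [Finset.mem_insert, Finset.mem_singleton] at hp
      rcases hp with rfl | rfl <;> simp [hj, hk, hne, hne.symm]
    rw [Finset.card_sdiff_of_subset hpair, Finset.card_pair (by simp [hne]), Finset.offDiag_card,
      ← Nat.mul_sub_one] at h1
    have h2 : (colCoreSet B).card * ((colCoreSet B).card - 1) ≤ (t + 3) * (t + 2) :=
      Nat.mul_le_mul (by omega) (by omega)
    have h3 : 2 ≤ (t + 3) * (t + 2) := by nlinarith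
    have h4 := h1.trans (Nat.sub_le_sub_right h2 2)
    have h5 : ({p ∈ agreePairs A a b | p.1 ∈ colCoreSet B ∧ p.2 ∈ colCoreSet B}.card : ℚ) ≤
      (((t + 3) * (t + 2) - 2 : ℕ) : ℚ) := by exact_mod_cast h4
    rw [Nat.cast_sub h3] at h5
    push_cast at h5
    exact h5
  · intro j hj k hk
    have hcc : (colCoreSet B).card = t + 3 := by
      by_contra hne
      refine hZ2 ((card_filter_mem_le (agreePairs A a b) (Finset.filter_subset _ _)
        (C := colCoreSet B) (c := t + 2) (by omega)).trans ?_)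
      push_cast
      have q3 : (0 : ℚ) ≤ t := Nat.cast_nonneg t
      nlinarith
    obtain ⟨c, hc, h⟩ := exists_mul_eq_of_spanDim_le_one B hBA
      (S := (colCoreSet B : Set κ)ᶜ) (by omega) (by simpa using hj) (by simpa using hk)
    exact ⟨c, hc, fun i hia hib => h ⟨i, hia, hib⟩⟩

end fullRank

section normalized

variable {ι κ : Type} [Fintype ι] [DecidableEq ι] [Fintype κ] [DecidableEq κ]

omit [Fintype ι] [DecidableEq ι] [DecidableEq κ] in
theorem mem_diffCols (A : Matrix ι κ ℚ) (a b : ι) (j : κ) :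
    j ∈ diffCols A a b ↔ A a j ≠ A b j := by
  simp [diffCols]

theorem card_diffCols_of_diagPer_lt {t : ℕ} (h₁ : PermBound (t + 4) (t + 3) (diagPer 2 (t + 2)))
    (h₂ : PermBound (t + 4) (t + 2) (diagPer 3 (t + 1)))
    (A : Matrix ι κ ℚ) (hA : ∀ i j, A i j = 1 ∨ A i j = -1)
    (hι : Fintype.card ι = t + 6) (hκ : Fintype.card κ = t + 6) (hr : A.rank = t + 6)
    (hlt : diagPer 1 (t + 5) < |genPer A|) {x y : ι} (hxy : x ≠ y) :
    (diffCols A x y).card = 1 ∨ (diffCols A x y).card = 2 ∨ (diffCols A x y).card = t + 4 ∨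
      (diffCols A x y).card = t + 5 := by
  have h := card_diffCols_of_full_rank A hA (hr.trans hι.symm) hxy
  by_contra hne
  rcases abs_genPer_le_or_columns t h₁ h₂ A hA hι hκ hr hxy (by omega) (by omega) with h' | h'
  · exact hlt.not_ge h'
  · omega

omit [DecidableEq κ] in
theorem eq_of_row_eq_of_full_rank (A : Matrix ι κ ℚ) (hA : ∀ i j, A i j = 1 ∨ A i j = -1)
    (hr : A.rank = Fintype.card ι) {x y : ι} (h : ∀ j, A x j = A y j) : x = y := by
  by_contra hxy
  have := (card_diffCols_of_full_rank A hA hr hxy).1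
  simp [diffCols, h] at this

/-- A nonsingular sign matrix whose rows each have at most one entry `-1`, none of them in
column `c`, is a row permutation of a sign diagonal matrix. -/
theorem genPer_eq_diagPer_of_rows {m : ℕ} (A : Matrix ι κ ℚ)
    (hA : ∀ i j, A i j = 1 ∨ A i j = -1) (hι : Fintype.card ι = m + 1)
    (hκ : Fintype.card κ = m + 1) (hr : A.rank = Fintype.card ι) (c : κ)
    (h : ∀ i, ∃ k, ∀ j, A i j = if k = j ∧ j ≠ c then -1 else 1) :
    genPer A = diagPer 1 m := by
  choose π hπ using h
  have hinj : Function.Injective π := fun x y hxy =>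
    eq_of_row_eq_of_full_rank A hA hr fun j => by rw [hπ, hπ, hxy]
  have hbij := (Fintype.bijective_iff_injective_and_card π).2 ⟨hinj, hι.trans hκ.symm⟩
  have hAe : A = (signDiag (Finset.univ.erase c)).submatrix (Equiv.ofBijective π hbij)
      (Equiv.refl κ) := by
    ext i j
    simp [hπ, signDiag]
  rw [hAe, genPer_submatrix_equiv, genPer_signDiag m 1 _ _ (by omega)]
  rw [Finset.card_erase_of_mem (Finset.mem_univ c), Finset.card_univ]
  omega

theorem abs_genPer_le_of_normalized {t : ℕ}
    (h₁ : PermBound (t + 4) (t + 3) (diagPer 2 (t + 2)))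
    (h₂ : PermBound (t + 4) (t + 2) (diagPer 3 (t + 1)))
    (A : Matrix ι κ ℚ) (hA : ∀ i j, A i j = 1 ∨ A i j = -1)
    (hι : Fintype.card ι = t + 6) (hκ : Fintype.card κ = t + 6) (hr : A.rank = t + 6)
    {a b : ι} (hab : a ≠ b) {p q c : κ} (hpq : p ≠ q) (hpc : p ≠ c) (hqc : q ≠ c)
    (hrow : ∀ i, i ≠ a → i ≠ b → A i p = 1 ∧ A i q = 1 ∧ A i c = 1)
    (ha : ∀ j, A a j = if j = q then -1 else 1) (hb : ∀ j, A b j = if j = p then -1 else 1) :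
    |genPer A| ≤ diagPer 1 (t + 5) := by
  by_contra! hlt
  have hrι := hr.trans hι.symm
  have hd := fun x y (hxy : x ≠ y) =>
    card_diffCols_of_diagPer_lt h₁ h₂ A hA hι hκ hr hlt hxy
  have hdT := fun x y (hxy : x ≠ y) =>
    card_diffCols_of_diagPer_lt h₁ h₂ Aᵀ (fun i j => hA j i) hκ hι
      ((Matrix.rank_transpose A).trans hr) (by rwa [genPer_transpose]) (x := x) (y := y) hxy
  set S : ι → Finset κ := fun i => {j | A i j = -1} with hS
  have hmem : ∀ i j, j ∈ S i ↔ A i j = -1 := fun i j => by simp [hS]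
  have hneg : ∀ i j, A i j = 1 ↔ A i j ≠ -1 := fun i j => by
    rcases hA i j with h | h <;> norm_num [h]
  have hinj : ∀ x y, S x = S y → x = y := fun x y hxy =>
    eq_of_row_eq_of_full_rank A hA hrι fun j => by
      have h1 := hmem x j
      rw [hxy, hmem] at h1
      rcases hA x j with h | h <;> rcases hA y j with h' | h' <;>
        first | exact h.trans h'.symm | norm_num [h, h'] at h1
  have hdiff : ∀ x y, diffCols A x y = symmDiff (S x) (S y) := fun x y => by
    ext j
    simp only [mem_diffCols, Finset.mem_symmDiff, hmem]
    rcases hA x j with h | h <;> rcases hA y j with h' | h' <;> norm_num [h, h']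
  have hSa : S a = {q} := by
    ext j
    rw [hmem, ha, Finset.mem_singleton]
    split_ifs <;> norm_num [*]
  have hSb : S b = {p} := by
    ext j
    rw [hmem, hb, Finset.mem_singleton]
    split_ifs <;> norm_num [*]
  have hT : ({p, q, c} : Finset κ)ᶜ.card = t + 3 := by
    rw [Finset.card_compl, Finset.card_eq_three.2 ⟨p, q, c, hpq, hpc, hqc, rfl⟩, hκ]
    rfl
  have hsub : ∀ i, i ≠ a → i ≠ b → S i ⊆ ({p, q, c} : Finset κ)ᶜ := fun i hia hib j hj => by
    obtain ⟨e1, e2, e3⟩ := hrow i hia hib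
    rw [hmem] at hj
    simp only [Finset.mem_compl, Finset.mem_insert, Finset.mem_singleton]
    rintro (rfl | rfl | rfl) <;> linarith
  have hcard : ∀ i, i ≠ a → i ≠ b →
      (S i).card = 0 ∨ (S i).card = 1 ∨ S i = ({p, q, c} : Finset κ)ᶜ := fun i hia hib => by
    have h1 := hd a i (Ne.symm hia)
    have hq : Disjoint (S a) (S i) := by
      rw [hSa, Finset.disjoint_singleton_left]
      exact fun h => by simpa using hsub i hia hib h
    rw [hdiff, hq.symmDiff_eq_sup, Finset.sup_eq_union, Finset.card_union_of_disjoint hq, hSa,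
      Finset.card_singleton] at h1
    have h2 := Finset.card_le_card (hsub i hia hib)
    by_cases h3 : (S i).card = t + 3
    · exact Or.inr (Or.inr (Finset.eq_of_subset_of_card_le (hsub i hia hib) (by omega)))
    · omega
  have hle : ∀ i, (S i).card ≤ 1 := by
    intro i
    by_cases hia : i = a
    · simp [hia, hSa]
    by_cases hib : i = b
    · simp [hib, hSb]
    rcases hcard i hia hib with h | h | h
    · omega
    · omega
    exfalso
    obtain ⟨i', hi'⟩ : ∃ i', i' ∉ ({a, b, i} : Finset ι) := by
      by_contra! hall
      have h1 := Finset.card_le_three (a := a) (b := b) (c := i)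
      rw [Finset.eq_univ_iff_forall.2 hall, Finset.card_univ] at h1
      omega
    simp only [Finset.mem_insert, Finset.mem_singleton, not_or] at hi'
    obtain ⟨hi'a, hi'b, hi'i⟩ := hi'
    rcases hcard i' hi'a hi'b with h' | h' | h'
    · have h1 := hd i i' (Ne.symm hi'i)
      rw [hdiff, Finset.card_eq_zero.1 h', h, ← Finset.bot_eq_empty, symmDiff_bot, hT] at h1
      omega
    · obtain ⟨j, hj⟩ := Finset.card_eq_one.1 h'
      have hjT : j ∈ ({p, q, c} : Finset κ)ᶜ := hsub i' hi'a hi'b (by simp [hj])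
      have hjn := hjT
      simp only [Finset.mem_compl, Finset.mem_insert, Finset.mem_singleton, not_or] at hjn
      obtain ⟨hjp, hjq, hjc⟩ := hjn
      have h1 := hdT p j (Ne.symm hjp)
      have h2 : diffCols Aᵀ p j = {b, i, i'} := by
        ext x
        simp only [mem_diffCols, Matrix.transpose_apply, Finset.mem_insert, Finset.mem_singleton]
        by_cases hxa : x = a
        · subst hxa
          simp [ha, hjq, hpq, hab, Ne.symm hia, Ne.symm hi'a]
        by_cases hxb : x = b
        · subst hxb
          norm_num [hb, hjp]
        rw [(hrow x hxa hxb).1, ne_comm, ne_eq, hneg, not_not, ← hmem]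
        constructor
        · intro hjx
          rcases hcard x hxa hxb with hx | hx | hx
          · simp [Finset.card_eq_zero.1 hx] at hjx
          · obtain ⟨k, hk⟩ := Finset.card_eq_one.1 hx
            rw [hk, Finset.mem_singleton] at hjx
            exact Or.inr (Or.inr (hinj _ _ (by rw [hk, hj, hjx])))
          · exact Or.inr (Or.inl (hinj _ _ (hx.trans h.symm)))
        · rintro (hx | rfl | rfl)
          · exact absurd hx hxb
          · rwa [h]
          · simp [hj]
      rw [h2, Finset.card_eq_three.2 ⟨b, i, i', Ne.symm hib, Ne.symm hi'b, Ne.symm hi'i, rfl⟩]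
        at h1
      omega
    · exact hi'i (hinj _ _ (h'.trans h.symm))
  have hc : ∀ i, c ∉ S i := fun i => by
    by_cases hia : i = a
    · simp [hia, hSa, Ne.symm hqc]
    by_cases hib : i = b
    · simp [hib, hSb, Ne.symm hpc]
    exact fun h => by simpa using hsub i hia hib h
  have hval : ∀ i j, A i j = if j ∈ S i then -1 else 1 := fun i j => by
    rcases hA i j with h | h <;> norm_num [hmem, h]
  have hone : ∀ i, ∃ k, ∀ j, A i j = if k = j ∧ j ≠ c then -1 else 1 := fun i => by
    rcases Nat.le_one_iff_eq_zero_or_eq_one.1 (hle i) with h0 | h0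
    · refine ⟨c, fun j => ?_⟩
      rw [hval, Finset.card_eq_zero.1 h0, if_neg (Finset.notMem_empty j), if_neg]
      exact fun h => h.2 h.1.symm
    · obtain ⟨k, hk⟩ := Finset.card_eq_one.1 h0
      have hkc : c ≠ k := by simpa [hk] using hc i
      refine ⟨k, fun j => ?_⟩
      rw [hval]
      refine if_congr ?_ rfl rfl
      rw [hk, Finset.mem_singleton]
      refine ⟨?_, fun h => h.1.symm⟩
      rintro rfl
      exact ⟨rfl, hkc.symm⟩
  refine hlt.not_ge ?_
  rw [genPer_eq_diagPer_of_rows (m := t + 5) A hA (by omega) (by omega) hrι c hone,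
    abs_of_nonneg (diagPer_nonneg 0 (t + 5))]

end normalized

section scaling

variable {ι κ : Type} [Fintype ι] [DecidableEq ι] [Fintype κ] [DecidableEq κ]

theorem rank_scale (A : Matrix ι κ ℚ) (u : ι → ℚ) (v : κ → ℚ)
    (hu : ∀ i, |u i| = 1) (hv : ∀ j, |v j| = 1) :
    (Matrix.of fun i j => u i * A i j * v j).rank = A.rank := by
  have h : (Matrix.of fun i j => u i * A i j * v j) =
      Matrix.diagonal u * A * Matrix.diagonal v := by
    ext i j
    simp [Matrix.mul_diagonal, Matrix.diagonal_mul]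
  have hne : ∀ x : ℚ, |x| = 1 → x ≠ 0 := by
    rintro x hx rfl
    simp at hx
  rw [h, Matrix.rank_mul_eq_left_of_isUnit_det, Matrix.rank_mul_eq_right_of_isUnit_det]
  · simpa [Matrix.det_diagonal, Finset.prod_ne_zero_iff] using fun i => hne _ (hu i)
  · simpa [Matrix.det_diagonal, Finset.prod_ne_zero_iff] using fun i => hne _ (hv i)

omit [Fintype ι] [DecidableEq ι] in
/-- If rows `a`, `b` agree, or disagree, on all but two columns, those two columns avoid any large
set on which the rows agree throughout or disagree throughout. -/
theorem exists_exceptional_pair {t : ℕ} (A : Matrix ι κ ℚ)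
    (hA : ∀ i j, A i j = 1 ∨ A i j = -1) (hκ : Fintype.card κ = t + 6) {a b : ι}
    (hs : (diffCols A a b).card = 2 ∨ (diffCols A a b).card = t + 4) {C : Finset κ}
    (hC : C.card = t + 3)
    (hcls : ∀ j ∈ C, ∀ k ∈ C, (j ∈ diffCols A a b ↔ k ∈ diffCols A a b)) :
    ∃ E : Finset κ, E.card = 2 ∧ E ⊆ Cᶜ ∧ ∃ ε : ℚ, ε * ε = 1 ∧
      ∀ j, A a j * A b j = if j ∈ E then -ε else ε := by
  have hval : ∀ j, A a j * A b j = if j ∈ diffCols A a b then -1 else 1 := fun j => by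
    rcases hA a j with h | h <;> rcases hA b j with h' | h' <;> norm_num [mem_diffCols, h, h']
  rcases hs with hs | hs
  · refine ⟨diffCols A a b, hs, fun j hj => Finset.mem_compl.2 fun hjC => ?_, 1, by norm_num, hval⟩
    have := Finset.card_le_card fun k hk => (hcls j hjC k hk).1 hj
    omega
  · have hs' : (diffCols A a b)ᶜ.card = 2 := by
      rw [Finset.card_compl]
      omega
    refine ⟨(diffCols A a b)ᶜ, hs', fun j hj => Finset.mem_compl.2 fun hjC => ?_, -1, by norm_num,
      fun j => ?_⟩
    · have := Finset.card_le_card fun k hk =>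
        Finset.mem_compl.2 fun hkD => Finset.mem_compl.1 hj ((hcls j hjC k hk).2 hkD)
      omega
    · rw [hval]
      by_cases h : j ∈ diffCols A a b <;> simp [h]

theorem abs_genPer_le_of_full_rank {t : ℕ}
    (h₁ : PermBound (t + 4) (t + 3) (diagPer 2 (t + 2)))
    (h₂ : PermBound (t + 4) (t + 2) (diagPer 3 (t + 1)))
    (A : Matrix ι κ ℚ) (hA : ∀ i j, A i j = 1 ∨ A i j = -1)
    (hι : Fintype.card ι = t + 6) (hκ : Fintype.card κ = t + 6) (hr : A.rank = t + 6) :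
    |genPer A| ≤ diagPer 1 (t + 5) := by
  obtain ⟨a, b, hs₁, hs₂⟩ := exists_two_le_card_diffCols A hA (by omega) (by omega)
  have hab := ne_of_card_diffCols_pos A (zero_lt_two.trans_le hs₁)
  rcases abs_genPer_le_or_columns t h₁ h₂ A hA hι hκ hr hab hs₁ (by omega) with
    h | ⟨hs, C, hC, hcls, hcol⟩
  · exact h
  obtain ⟨E, hE, hEC, ε, hε, hval⟩ := exists_exceptional_pair A hA hκ hs hC hcls
  obtain ⟨p, q, hpq, rfl⟩ := Finset.card_eq_two.1 hE
  obtain ⟨c, hcC, hcE⟩ : ∃ c ∈ Cᶜ, c ∉ ({p, q} : Finset κ) := by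
    refine Finset.exists_mem_notMem_of_card_lt_card ?_
    rw [Finset.card_compl]
    omega
  have hpC := Finset.mem_compl.1 (hEC (show p ∈ _ by simp))
  have hqC := Finset.mem_compl.1 (hEC (show q ∈ _ by simp))
  rw [Finset.mem_compl] at hcC
  simp only [Finset.mem_insert, Finset.mem_singleton, not_or] at hcE
  obtain ⟨hcp, hcq⟩ := hcE
  obtain ⟨x, hx, hxcol⟩ := hcol c hcC p hpC
  obtain ⟨y, hy, hycol⟩ := hcol c hcC q hqC
  have habs : ∀ i j, |A i j| = 1 := fun i j => by rcases hA i j with h | h <;> simp [h]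
  have hsq : ∀ z : ℚ, |z| = 1 → z * z = 1 := fun z hz => by rw [← abs_mul_abs_self, hz, one_mul]
  have hAsq : ∀ i j, A i j * A i j = 1 := fun i j => hsq _ (habs i j)
  set u : ι → ℚ := fun i => A i c with hu
  set v : κ → ℚ := fun j => if j = p then x else if j = q then y else A a c * A a j with hv
  have hu1 : ∀ i, |u i| = 1 := fun i => habs i c
  have hv1 : ∀ j, |v j| = 1 := fun j => by
    simp only [hv]
    split_ifs
    · exact hx
    · exact hy
    · rw [abs_mul, habs, habs, one_mul]
  have hvp : v p = x := by simp [hv]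
  have hvq : v q = y := by simp [hv, Ne.symm hpq]
  have hvj : ∀ j, j ≠ p → j ≠ q → v j = A a c * A a j := fun j h h' => by simp [hv, h, h']
  set B : Matrix ι κ ℚ := Matrix.of fun i j => u i * A i j * v j with hB
  have hBv : ∀ i j, B i j = A i c * A i j * v j := fun i j => rfl
  have hBA : ∀ i j, B i j = 1 ∨ B i j = -1 := fun i j => by
    refine eq_or_eq_neg_of_abs_eq ?_
    rw [hBv, abs_mul, abs_mul, habs, habs, hv1]
    norm_num
  have hBr : B.rank = t + 6 := (rank_scale A u v hu1 hv1).trans hr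
  have hrow : ∀ i, i ≠ a → i ≠ b → B i p = 1 ∧ B i q = 1 ∧ B i c = 1 := fun i hia hib => by
    refine ⟨?_, ?_, ?_⟩
    · rw [hBv, hvp, hxcol i hia hib]
      linear_combination x * x * hAsq i c + hsq x hx
    · rw [hBv, hvq, hycol i hia hib]
      linear_combination y * y * hAsq i c + hsq y hy
    · rw [hBv, hvj c hcp hcq, hAsq, hAsq, one_mul]
  have hBa : ∀ j, j ≠ p → j ≠ q → B a j = 1 := fun j h h' => by
    rw [hBv, hvj j h h']
    linear_combination A a j * A a j * hAsq a c + hAsq a j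
  have hc := hval c
  rw [if_neg (by simp [hcp, hcq])] at hc
  have hBb : ∀ j, j ≠ p → j ≠ q → B b j = 1 := fun j h h' => by
    have hj := hval j
    rw [if_neg (by simp [h, h'])] at hj
    rw [hBv, hvj j h h']
    linear_combination A a j * A b j * hc + ε * hj + hε
  have hBp : B a p * B b p = -1 := by
    have hj := hval p
    rw [if_pos (by simp)] at hj
    rw [hBv, hBv, hvp]
    linear_combination x * x * A a p * A b p * hc + x * x * ε * hj - ε * ε * hsq x hx - hε
  have hBq : B a q * B b q = -1 := by
    have hj := hval q
    rw [if_pos (by simp)] at hj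
    rw [hBv, hBv, hvq]
    linear_combination y * y * A a q * A b q * hc + y * y * ε * hj - ε * ε * hsq y hy - hε
  have hne : B a p ≠ B a q := fun h => by
    refine hpq (eq_of_row_eq_of_full_rank Bᵀ (fun i j => hBA j i) ?_ fun i => ?_)
    · rw [Matrix.rank_transpose, hBr, hκ]
    · rw [Matrix.transpose_apply, Matrix.transpose_apply]
      by_cases hia : i = a
      · rw [hia, h]
      by_cases hib : i = b
      · rcases hBA a q with h' | h' <;> rw [h, h'] at hBp <;> rw [h'] at hBq <;> rw [hib] <;>
          linarith
      · rw [(hrow i hia hib).1, (hrow i hia hib).2.1]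
  rw [← abs_genPer_scale A u v hu1 hv1]
  rcases hBA a p with hap | hap <;> rcases hBA a q with haq | haq
  · exact absurd (hap.trans haq.symm) hne
  · refine abs_genPer_le_of_normalized h₁ h₂ B hBA hι hκ hBr hab hpq (Ne.symm hcp) (Ne.symm hcq)
      hrow (fun j => ?_) fun j => ?_
    · split_ifs with h
      · rw [h, haq]
      · by_cases h' : j = p
        · rw [h', hap]
        · exact hBa j h' h
    · split_ifs with h
      · rw [h]
        linear_combination hBp - B b p * hap
      · by_cases h' : j = q
        · rw [h']
          linear_combination B b q * haq - hBq
        · exact hBb j h h'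
  · refine abs_genPer_le_of_normalized h₁ h₂ B hBA hι hκ hBr hab (Ne.symm hpq) (Ne.symm hcq)
      (Ne.symm hcp) (fun i hia hib => ⟨(hrow i hia hib).2.1, (hrow i hia hib).1,
        (hrow i hia hib).2.2⟩) (fun j => ?_) fun j => ?_
    · split_ifs with h
      · rw [h, hap]
      · by_cases h' : j = q
        · rw [h', haq]
        · exact hBa j h h'
    · split_ifs with h
      · rw [h]
        linear_combination hBq - B b q * haq
      · by_cases h' : j = p
        · rw [h']
          linear_combination B b p * hap - hBp
        · exact hBb j h' h
  · exact absurd (hap.trans haq.symm) hne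

end scaling

section main

theorem abs_genPer_five_le_diagPer {ι κ : Type} [Fintype ι] [DecidableEq ι] [Fintype κ]
    [DecidableEq κ] (A : Matrix ι κ ℚ) (hA : ∀ i j, A i j = 1 ∨ A i j = -1)
    (hι : Fintype.card ι = 5) (hκ : Fintype.card κ = 5) {a r : ℕ} (har : a + 1 + (r + 1) = 5)
    (hr : A.rank = r + 1 + 1) : |genPer A| ≤ diagPer (a + 1) (r + 1) := by
  obtain ⟨rfl, rfl⟩ | ⟨rfl, rfl⟩ | ⟨rfl, rfl⟩ | ⟨rfl, rfl⟩ :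
      a = 3 ∧ r = 0 ∨ a = 2 ∧ r = 1 ∨ a = 1 ∧ r = 2 ∨ a = 0 ∧ r = 3 := by omega
  · have h := abs_genPer_le_of_rank_lt A hA hι hκ hr (by omega) (permBound_factorial 4 1)
      permBound_four_two (by norm_num [Nat.factorial])
    norm_num [diagPer, Nat.factorial] at h ⊢
    linarith
  · have h := abs_genPer_le_of_rank_lt A hA hι hκ hr (by omega) permBound_four_two
      permBound_four_three (by norm_num)
    norm_num [diagPer, Nat.factorial] at h ⊢
    linarith
  · have h := abs_genPer_five_le_of_rank_four A hA hι hκ hr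
    norm_num [diagPer, Nat.factorial] at h ⊢
    linarith
  · have h := abs_genPer_five_le_of_rank_five A hA hι hκ hr
    norm_num [diagPer, Nat.factorial] at h ⊢
    linarith

theorem permBound_of_rank_eq {n : ℕ} (h : ∀ a r, a + 1 + r = n →
      ∀ {ι κ : Type} [Fintype ι] [DecidableEq ι] [Fintype κ] [DecidableEq κ] (A : Matrix ι κ ℚ),
        Fintype.card ι = n → Fintype.card κ = n → (∀ i j, A i j = 1 ∨ A i j = -1) →
        A.rank = r + 1 → |genPer A| ≤ diagPer (a + 1) r) {a r : ℕ} (har : a + 1 + r = n) :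
    PermBound n (r + 1) (diagPer (a + 1) r) := by
  intro ι κ _ _ _ _ A hι hκ hA hr
  obtain ⟨k, hk⟩ := Nat.exists_eq_add_of_le hr
  have hle := A.rank_le_card_height
  obtain ⟨a', rfl⟩ : ∃ a', a = a' + k := ⟨a - k, by omega⟩
  refine (h a' (r + k) (by omega) A hι hκ hA (by omega)).trans ?_
  have := diagPer_antitone a' r k
  rwa [add_right_comm] at this

theorem permBound_diagPer {n : ℕ} (hn : 5 ≤ n) : ∀ {a r : ℕ}, a + 1 + r = n →
    PermBound n (r + 1) (diagPer (a + 1) r) := by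
  induction n using Nat.strong_induction_on with
  | _ n ih =>
    refine permBound_of_rank_eq fun a r har ι κ _ _ _ _ A hι hκ hA hr => ?_
    rcases r with _ | r
    · have := permBound_factorial n 0 A hι hκ hA (Nat.zero_le _)
      rwa [← har] at this
    obtain rfl | hn' := hn.eq_or_lt
    · exact abs_genPer_five_le_diagPer A hA hι hκ har hr
    rcases a with _ | a
    · obtain ⟨t, rfl⟩ := Nat.exists_eq_add_of_le' (show 6 ≤ n from hn')
      obtain rfl : r = t + 4 := by omega
      have h : PermBound (t + 4) (t + 3) (diagPer 2 (t + 2)) ∧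
          PermBound (t + 4) (t + 2) (diagPer 3 (t + 1)) := by
        rcases t with _ | t
        · have e₁ : diagPer 2 2 = 8 := by norm_num [diagPer, Nat.factorial]
          have e₂ : diagPer 3 1 = 12 := by norm_num [diagPer, Nat.factorial]
          rw [zero_add, e₁, e₂]
          exact ⟨permBound_four_three, permBound_four_two⟩
        · exact ⟨ih (t + 5) (by omega) (by omega) (a := 1) (by omega),
            ih (t + 5) (by omega) (by omega) (a := 2) (by omega)⟩
      exact abs_genPer_le_of_full_rank h.1 h.2 A hA hι hκ hr
    · have hsize : n = a + 1 + (r + 1) + 1 := by omega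
      have h := abs_genPer_le_of_rank_lt A hA (hι.trans hsize) (hκ.trans hsize) hr (by omega)
        (ih _ (by omega) (by omega) (a := a + 1) (by omega))
        (ih _ (by omega) (by omega) (a := a) (by omega)) (diagPer_antitone a r 1)
      have e := diagPer_expand r (a + 1)
      push_cast at h e
      linarith

theorem per_Dmat {n r : ℕ} (h : r ≤ n) : per (Dmat n r) = diagPer (n - r) r := by
  have hD : Dmat n r = signDiag (Finset.univ.filter fun j : Fin n => (j : ℕ) < r) := by
    ext i j
    simp [Dmat, signDiag, Fin.ext_iff]
  rw [hD]
  refine genPer_signDiag r (n - r) _ ?_ ?_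
  · rw [Fin.card_filter_val_lt, min_eq_right h]
  · rw [Fintype.card_fin]
    omega

end main

theorem krauter_bound (n r : ℕ) (hn : 5 ≤ n) (hr : r ≤ n - 1)
    (A : Matrix (Fin n) (Fin n) ℚ) (hA : ∀ i j, A i j = 1 ∨ A i j = -1)
    (hrk : A.rank = r + 1) :
    |per A| ≤ per (Dmat n r) := by
  obtain ⟨a, ha⟩ := Nat.exists_eq_add_of_le' hr
  rw [per_Dmat (by omega), show n - r = a + 1 by omega]
  exact permBound_diagPer hn (by omega) A (Fintype.card_fin n) (Fintype.card_fin n) hA hrk.ge
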